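/- (Energy conservation of the Crank–Nicolson starting step.) Let m be a positive integer, a, b, c, ν real constants, α, λ > 0, and τ > 0. Let U⁰, U¹ ∈ Z_h^0 be mesh functions satisfying, for all 2 ≤ i ≤ M−2, the Crank–Nicolson equation (U¹_i − U⁰_i)/τ + a (Q_{x̂})_i + (b/(m+2)) [ (Q_i)^m (Q_{x̂})_i + ((Q^m Q)_{x̂})_i ] − α ((U¹ − U⁰)_{x x̄})_i/τ + c (Q_{x x̄ x̂})_i + λ ((U¹ − U⁰)_{x x x̄ x̄})_i/τ − ν (Q_{x x x̄ x̄ x̂})_i = 0, where Q = (U¹ + U⁰)/2 and ((Q^m Q)_{x̂})_i = ((Q_{i+1})^{m+1} − (Q_{i−1})^{m+1})/(2h). Then ‖U¹‖² + α‖U¹_x‖² + λ‖U¹_{x x̄}‖² = ‖U⁰‖² + α‖U⁰_x‖² + λ‖U⁰_{x x̄}‖². -/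

import Mathlib

theorem tele_aux (G : ℤ → ℝ) (n : ℕ) :
    ∑ i ∈ Finset.Icc (1 : ℤ) (n : ℤ), (G (i + 1) - G i) = G (n + 1) - G 1 := by
  induction n with
  | zero => simp
  | succ k ih =>
    have : Finset.Icc (1 : ℤ) ((k + 1 : ℕ) : ℤ)
        = insert ((k : ℤ) + 1) (Finset.Icc (1 : ℤ) (k : ℤ)) := by
      ext x
      simp only [Finset.mem_Icc, Finset.mem_insert]
      omega
    rw [this, Finset.sum_insert (by simp), ih]
    push_cast
    ring

/-- Energy conservation of the Crank–Nicolson starting step: if `U⁰, U¹ ∈ Z_h^0` satisfy the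
Crank–Nicolson scheme with `Q = (U¹ + U⁰)/2`, then
`‖U¹‖² + α‖U¹_x‖² + λ‖U¹_{x x̄}‖² = ‖U⁰‖² + α‖U⁰_x‖² + λ‖U⁰_{x x̄}‖²`. -/
theorem stmt_15 (M : ℤ) (hM : 4 ≤ M) (h : ℝ) (hh : 0 < h)
    (m : ℕ) (hm : 0 < m) (a b c ν α lam τ : ℝ) (hα : 0 < α) (hlam : 0 < lam) (hτ : 0 < τ)
    (U0 U1 Q : ℤ → ℝ)
    (hU0 : ∀ i : ℤ, (i ≤ 1 ∨ M - 1 ≤ i) → U0 i = 0)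
    (hU1 : ∀ i : ℤ, (i ≤ 1 ∨ M - 1 ≤ i) → U1 i = 0)
    (hQ : ∀ i : ℤ, Q i = (U1 i + U0 i) / 2)
    (scheme : ∀ i : ℤ, 2 ≤ i → i ≤ M - 2 →
      (U1 i - U0 i) / τ
        + a * ((Q (i + 1) - Q (i - 1)) / (2 * h))
        + (b / (m + 2)) * ((Q i) ^ m * ((Q (i + 1) - Q (i - 1)) / (2 * h))
            + ((Q (i + 1)) ^ (m + 1) - (Q (i - 1)) ^ (m + 1)) / (2 * h))
        - α * (((U1 (i + 1) - U0 (i + 1)) - 2 * (U1 i - U0 i) + (U1 (i - 1) - U0 (i - 1)))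
            / h ^ 2) / τ
        + c * ((Q (i + 2) - 2 * Q (i + 1) + 2 * Q (i - 1) - Q (i - 2)) / (2 * h ^ 3))
        + lam * (((U1 (i + 2) - U0 (i + 2)) - 4 * (U1 (i + 1) - U0 (i + 1)) + 6 * (U1 i - U0 i)
            - 4 * (U1 (i - 1) - U0 (i - 1)) + (U1 (i - 2) - U0 (i - 2))) / h ^ 4) / τ
        - ν * ((Q (i + 3) - 4 * Q (i + 2) + 5 * Q (i + 1) - 5 * Q (i - 1) + 4 * Q (i - 2)
            - Q (i - 3)) / (2 * h ^ 5))
        = 0) :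
    (h * ∑ i ∈ Finset.Icc (1 : ℤ) (M - 1), (U1 i) ^ 2)
      + α * (h * ∑ i ∈ Finset.Icc (1 : ℤ) (M - 1), ((U1 (i + 1) - U1 i) / h) ^ 2)
      + lam * (h * ∑ i ∈ Finset.Icc (1 : ℤ) (M - 1),
          ((U1 (i + 1) - 2 * U1 i + U1 (i - 1)) / h ^ 2) ^ 2)
    = (h * ∑ i ∈ Finset.Icc (1 : ℤ) (M - 1), (U0 i) ^ 2)
      + α * (h * ∑ i ∈ Finset.Icc (1 : ℤ) (M - 1), ((U0 (i + 1) - U0 i) / h) ^ 2)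
      + lam * (h * ∑ i ∈ Finset.Icc (1 : ℤ) (M - 1),
          ((U0 (i + 1) - 2 * U0 i + U0 (i - 1)) / h ^ 2) ^ 2) := by
  have hU1Q : ∀ j, U1 j = 2 * Q j - U0 j := fun j => by rw [hQ]; ring
  have hQ0 : ∀ i : ℤ, (i ≤ 1 ∨ M - 1 ≤ i) → Q i = 0 := fun i hi => by
    rw [hQ, hU0 i hi, hU1 i hi]; ring
  obtain ⟨G, hG⟩ : ∃ G : ℤ → ℝ, ∀ i, G i =
      h * (α / h ^ 2 * (2 * Q i * ((U1 i - U0 i) - (U1 (i - 1) - U0 (i - 1))))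
        + lam / h ^ 4 * (2 * Q i * ((U1 i - U0 i) - 2 * (U1 (i - 1) - U0 (i - 1))
              + (U1 (i - 2) - U0 (i - 2)))
            - 2 * Q (i - 1) * ((U1 (i + 1) - U0 (i + 1)) - 2 * (U1 i - U0 i)
              + (U1 (i - 1) - U0 (i - 1)))))
      - 2 * τ * h * (a / (2 * h) * (Q (i - 1) * Q i)
        + b / (m + 2) / (2 * h) * (Q (i - 1) ^ (m + 1) * Q i + Q (i - 1) * Q i ^ (m + 1))
        + c / (2 * h ^ 3) * ((Q (i - 2) * Q i + Q (i - 1) * Q (i + 1)) - 2 * (Q (i - 1) * Q i))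
        - ν / (2 * h ^ 5) * ((Q (i - 3) * Q i + Q (i - 2) * Q (i + 1) + Q (i - 1) * Q (i + 2))
            - 4 * (Q (i - 2) * Q i + Q (i - 1) * Q (i + 1)) + 5 * (Q (i - 1) * Q i))) :=
    ⟨_, fun _ => rfl⟩
  have hG1 : G 1 = 0 := by
    rw [hG, hQ0 1 (by omega), hQ0 (1 - 1) (by omega), hQ0 (1 - 2) (by omega)]
    simp
  have hGM : G M = 0 := by
    rw [hG, hQ0 M (by omega), hQ0 (M - 1) (by omega), hQ0 (M + 1) (by omega)]
    simp
  have hτ1 : τ * τ⁻¹ = 1 := mul_inv_cancel₀ hτ.ne'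
  have key : ∀ i ∈ Finset.Icc (1 : ℤ) (M - 1),
      (h * (U1 i) ^ 2 + α * (h * ((U1 (i + 1) - U1 i) / h) ^ 2)
        + lam * (h * ((U1 (i + 1) - 2 * U1 i + U1 (i - 1)) / h ^ 2) ^ 2))
      - (h * (U0 i) ^ 2 + α * (h * ((U0 (i + 1) - U0 i) / h) ^ 2)
        + lam * (h * ((U0 (i + 1) - 2 * U0 i + U0 (i - 1)) / h ^ 2) ^ 2))
      = G (i + 1) - G i := by
    intro i hi
    rw [Finset.mem_Icc] at hi
    have hs := mul_eq_zero.2 (show Q i = 0 ∨ _ = (0 : ℝ) from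
      (by_cases (p := 2 ≤ i ∧ i ≤ M - 2) (fun hc => Or.inr (scheme i hc.1 hc.2))
        (fun hc => Or.inl (hQ0 i (by omega)))))
    rw [hG, hG, show i + 1 - 1 = i by ring, show i + 1 - 2 = i - 1 by ring,
      show i + 1 - 3 = i - 2 by ring, show i + 1 + 1 = i + 2 by ring,
      show i + 1 + 2 = i + 3 by ring]
    simp only [hU1Q] at hs ⊢
    clear scheme hG hQ hU1Q
    linear_combination (2 * τ * h) * hs - 2 * h * Q i * ((2 * Q i - 2 * U0 i)
      - α * ((2 * Q (i + 1) - 2 * U0 (i + 1)) - 2 * (2 * Q i - 2 * U0 i)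
        + (2 * Q (i - 1) - 2 * U0 (i - 1))) / h ^ 2
      + lam * ((2 * Q (i + 2) - 2 * U0 (i + 2)) - 4 * (2 * Q (i + 1) - 2 * U0 (i + 1))
        + 6 * (2 * Q i - 2 * U0 i) - 4 * (2 * Q (i - 1) - 2 * U0 (i - 1))
        + (2 * Q (i - 2) - 2 * U0 (i - 2))) / h ^ 4) * hτ1
  have hsum := Finset.sum_congr rfl key
  have ht := tele_aux G (M - 1).toNat
  rw [Int.toNat_of_nonneg (by omega), sub_add_cancel, hG1, hGM] at ht
  rw [ht, Finset.sum_sub_distrib] at hsum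
  simp only [Finset.sum_add_distrib, ← Finset.mul_sum] at hsum
  linarith
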